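/- For every sequence w : ℤ → ℂ with Σ_{n∈ℤ} (1+α_n²)^{1/2} |w_n|² < ∞, the series S := L·Σ_{n∈ℤ} i·β_n·|w_n|² converges absolutely and Re S = −L·Σ_{n : α_n² > k²ε} √(α_n² − k²ε)·|w_n|², which is ≤ 0. -/

import Mathlib

/-- The DtN coefficient with squared wave number `κ` and squared frequency `a` is bounded by a
multiple of the `H^{1/2}` weight `√(1 + a)`. -/
theorem norm_dtn_coeff_le {κ a : ℝ} (hκ : 0 ≤ κ) (ha : 0 ≤ a) :
    ‖(if a ≤ κ then (Real.sqrt (κ - a) : ℂ) else Complex.I * (Real.sqrt (a - κ) : ℂ))‖ ≤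
      Real.sqrt (1 + κ) * Real.sqrt (1 + a) := by
  rw [← Real.sqrt_mul (by positivity)]
  split_ifs
  · rw [Complex.norm_real, Real.norm_of_nonneg (Real.sqrt_nonneg _)]
    exact Real.sqrt_le_sqrt (by nlinarith [mul_nonneg hκ ha])
  · rw [norm_mul, Complex.norm_I, one_mul, Complex.norm_real,
      Real.norm_of_nonneg (Real.sqrt_nonneg _)]
    exact Real.sqrt_le_sqrt (by nlinarith [mul_nonneg hκ ha])

/-- Only the evanescent modes `κ < a` contribute to the real part of the DtN form. -/
theorem re_dtn_term (L κ a r : ℝ) :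
    ((L : ℂ) * (Complex.I *
      (if a ≤ κ then (Real.sqrt (κ - a) : ℂ) else Complex.I * (Real.sqrt (a - κ) : ℂ)) *
        (r : ℂ) ^ 2)).re =
      -(L * (if κ < a then Real.sqrt (a - κ) * r ^ 2 else 0)) := by
  rw [Complex.re_ofReal_mul, ← Complex.ofReal_pow, Complex.re_mul_ofReal]
  by_cases h : a ≤ κ
  · simp [h, not_lt.mpr h]
  · simp [h, not_le.mp h]

/-- Lemma 3.5, second identity: sign of the real part of the DtN form.
For every `w : ℤ → ℂ` with `Σ (1+α_n²)^{1/2}|w_n|² < ∞`, the series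
`S = L Σ i β_n |w_n|²` converges absolutely and
`Re S = −L Σ_{α_n² > k²ε} √(α_n² − k²ε)|w_n|² ≤ 0`. -/
theorem dtn_form_real_part
    (L α₀ k ε : ℝ) (hL : 0 < L) (hk : 0 < k) (hε : 0 < ε)
    (α : ℤ → ℝ) (hα : ∀ n : ℤ, α n = α₀ + 2 * Real.pi * n / L)
    (β : ℤ → ℂ)
    (hβ : ∀ n : ℤ, β n =
      if (α n) ^ 2 ≤ k ^ 2 * ε then (Real.sqrt (k ^ 2 * ε - (α n) ^ 2) : ℂ)
      else Complex.I * (Real.sqrt ((α n) ^ 2 - k ^ 2 * ε) : ℂ))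
    (w : ℤ → ℂ)
    (hw : Summable (fun n : ℤ => Real.sqrt (1 + (α n) ^ 2) * ‖w n‖ ^ 2)) :
    Summable (fun n : ℤ => ‖(L : ℂ) * (Complex.I * β n * (‖w n‖ : ℂ) ^ 2)‖) ∧
    Summable (fun n : ℤ =>
      if k ^ 2 * ε < (α n) ^ 2 then Real.sqrt ((α n) ^ 2 - k ^ 2 * ε) * ‖w n‖ ^ 2 else 0) ∧
    (∑' n : ℤ, (L : ℂ) * (Complex.I * β n * (‖w n‖ : ℂ) ^ 2)).re =
      -(L * ∑' n : ℤ,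
        (if k ^ 2 * ε < (α n) ^ 2 then Real.sqrt ((α n) ^ 2 - k ^ 2 * ε) * ‖w n‖ ^ 2 else 0)) ∧
    (∑' n : ℤ, (L : ℂ) * (Complex.I * β n * (‖w n‖ : ℂ) ^ 2)).re ≤ 0 := by
  have hκ : 0 ≤ k ^ 2 * ε := by positivity
  have hS : Summable (fun n : ℤ => ‖(L : ℂ) * (Complex.I * β n * (‖w n‖ : ℂ) ^ 2)‖) := by
    refine (hw.mul_left (L * Real.sqrt (1 + k ^ 2 * ε))).of_nonneg_of_le
      (fun n => norm_nonneg _) fun n => ?_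
    have hb : ‖β n‖ ≤ Real.sqrt (1 + k ^ 2 * ε) * Real.sqrt (1 + (α n) ^ 2) :=
      hβ n ▸ norm_dtn_coeff_le hκ (sq_nonneg (α n))
    calc ‖(L : ℂ) * (Complex.I * β n * (‖w n‖ : ℂ) ^ 2)‖ = L * (‖β n‖ * ‖w n‖ ^ 2) := by
          simp [abs_of_pos hL]
      _ ≤ L * (Real.sqrt (1 + k ^ 2 * ε) * Real.sqrt (1 + (α n) ^ 2) * ‖w n‖ ^ 2) := by gcongr
      _ = _ := by ring
  have hre (n : ℤ) : ((L : ℂ) * (Complex.I * β n * (‖w n‖ : ℂ) ^ 2)).re =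
      -(L * (if k ^ 2 * ε < (α n) ^ 2 then
        Real.sqrt ((α n) ^ 2 - k ^ 2 * ε) * ‖w n‖ ^ 2 else 0)) := by
    rw [hβ n]
    exact re_dtn_term L _ _ _
  have hsum := Complex.hasSum_re hS.of_norm.hasSum
  simp only [hre] at hsum
  have hT : Summable (fun n : ℤ => if k ^ 2 * ε < (α n) ^ 2 then
      Real.sqrt ((α n) ^ 2 - k ^ 2 * ε) * ‖w n‖ ^ 2 else 0) :=
    (summable_mul_left_iff hL.ne').mp (summable_neg_iff.mp hsum.summable)
  have heq := hsum.unique (hT.hasSum.mul_left L).neg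
  refine ⟨hS, hT, heq, heq.trans_le (neg_nonpos.mpr (mul_nonneg hL.le (tsum_nonneg fun n => ?_)))⟩
  split_ifs <;> positivity
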